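/- Let G be a finite connected graph without boundary, and let G' be the ∂-graph obtained by declaring a single vertex x to be a boundary vertex. Then L_std(ℤ(V∖{x})) = L_std(ℤV), and consequently Υ_ℤ(G', L_std) = Υ_ℤ(G, L_std); moreover U₀(G', L_std, ℚ/ℤ) ≅ Crit(G). -/

import Mathlib

open Finsupp

/-- A graph with boundary (`∂`-graph) together with a generalized Laplacian datum over `R`:
oriented edges with a fixed-point-free reversal involution, local finiteness,
a set of boundary vertices, symmetric edge weights `w` and diagonal perturbation `d`. -/
structure DNetwork (R : Type) [CommRing R] where
  V : Type
  E : Type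
  src : E → V
  rev : E → E
  rev_rev : ∀ e, rev (rev e) = e
  rev_ne : ∀ e, rev e ≠ e
  finE : ∀ x : V, Fintype {e : E // src e = x}
  boundary : Set V
  w : E → R
  w_rev : ∀ e, w (rev e) = w e
  d : V → R

namespace DNetwork

variable {R : Type} [CommRing R] (N : DNetwork R)

/-- The endpoint of an oriented edge. -/
def tgt (e : N.E) : N.V := N.src (N.rev e)

/-- The generalized Laplacian evaluated at the vertex `x`, as a linear functional on
`M`-valued functions: `Lu(x) = d(x) u(x) + ∑_{e : e₊ = x} w(e) (u(x) - u(e₋))`. -/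
noncomputable def lapAt {M : Type} [AddCommGroup M] [Module R M] (x : N.V) :
    (N.V → M) →ₗ[R] M :=
  letI := N.finE x
  N.d x • (LinearMap.proj x : (N.V → M) →ₗ[R] M) +
    ∑ e : {e : N.E // N.src e = x},
      N.w e.1 • ((LinearMap.proj x : (N.V → M) →ₗ[R] M) - LinearMap.proj (N.tgt e.1))

/-- The generalized Laplacian applied to the basis chain at the vertex `x`. -/
noncomputable def lapSingle (x : N.V) : N.V →₀ R :=
  letI := N.finE x
  N.d x • Finsupp.single x 1 +
    ∑ e : {e : N.E // N.src e = x},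
      N.w e.1 • (Finsupp.single x 1 - Finsupp.single (N.tgt e.1) 1)

/-- The generalized Laplacian as a linear endomorphism of the module `RV` of `0`-chains. -/
noncomputable def chainLap : (N.V →₀ R) →ₗ[R] (N.V →₀ R) :=
  Finsupp.lsum R fun x => LinearMap.toSpanSingleton R _ (N.lapSingle x)

/-- The set of interior vertices. -/
def interior : Set N.V := N.boundaryᶜ

/-- The submodule `L(RV°)` of `RV`. -/
noncomputable def lapImage : Submodule R (N.V →₀ R) :=
  Submodule.map N.chainLap (Finsupp.supported R R N.interior)

/-- The fundamental module `Υ(G,L) = RV / L(RV°)`. -/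
abbrev Upsilon := (N.V →₀ R) ⧸ N.lapImage

/-- The submodule of `M`-valued harmonic functions `U(G,L,M)`. -/
noncomputable def harmonic (M : Type) [AddCommGroup M] [Module R M] :
    Submodule R (N.V → M) :=
  ⨅ x ∈ N.interior, LinearMap.ker (N.lapAt (M := M) x)

/-- The module `U₀(G,L,M)` of finitely supported `M`-valued functions `u` with
`u = 0` on the boundary and `Lu ≡ 0` everywhere. -/
noncomputable def U0 (M : Type) [AddCommGroup M] [Module R M] :
    Submodule R (N.V →₀ M) :=
  (⨅ x ∈ N.boundary, LinearMap.ker (Finsupp.lapply (M := M) (R := R) x)) ⊓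
    (⨅ x : N.V, LinearMap.ker ((N.lapAt (M := M) x).comp Finsupp.lcoeFun))

/-- Adjacency via an oriented edge. -/
def Adj (x y : N.V) : Prop := ∃ e : N.E, N.src e = x ∧ N.tgt e = y

/-- Connectivity of the underlying graph. -/
def Connected : Prop := ∀ x y : N.V, Relation.ReflTransGen N.Adj x y

end DNetwork

/-- The augmentation map `ε : ℤV → ℤ` summing coordinates. -/
noncomputable def epsMap (N : DNetwork ℤ) : (N.V →₀ ℤ) →ₗ[ℤ] ℤ :=
  Finsupp.lsum ℤ fun _ => LinearMap.id

/-- The `∂`-graph obtained by re-declaring the set of boundary vertices to be `s`. -/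
def DNetwork.setBdry {R : Type} [CommRing R] (N : DNetwork R) (s : Set N.V) : DNetwork R :=
  { N with boundary := s }

namespace DNetwork

variable {R : Type} [CommRing R] (N : DNetwork R)

/-- A locally finite graph on finitely many vertices has finitely many oriented edges. -/
@[reducible]
noncomputable def fintypeEdge [Fintype N.V] : Fintype N.E :=
  letI := N.finE
  Fintype.ofEquiv (Σ v : N.V, {e : N.E // N.src e = v}) (Equiv.sigmaFiberEquiv N.src)

/-- Edge reversal as a permutation of the oriented edges. -/
def revEquiv : N.E ≃ N.E := ⟨N.rev, N.rev, N.rev_rev, N.rev_rev⟩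

theorem tgt_rev (e : N.E) : N.tgt (N.rev e) = N.src e := by
  simp [tgt, N.rev_rev]

theorem lapAt_apply {M : Type} [AddCommGroup M] [Module R M] (y : N.V) (u : N.V → M) :
    N.lapAt y u = letI := N.finE y
      N.d y • u y + ∑ e : {e : N.E // N.src e = y}, N.w e.1 • (u y - u (N.tgt e.1)) := by
  simp [lapAt, LinearMap.sum_apply]

theorem map_lapAt {M M' : Type} [AddCommGroup M] [Module R M] [AddCommGroup M'] [Module R M']
    (φ : M →ₗ[R] M') (y : N.V) (u : N.V → M) :
    φ (N.lapAt y u) = N.lapAt y (fun v => φ (u v)) := by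
  simp [lapAt_apply, map_sum]

theorem sum_src_eq [Fintype N.E] [DecidableEq N.V] {M : Type} [AddCommMonoid M] (y : N.V)
    (g : N.E → M) :
    (letI := N.finE y; ∑ e : {e : N.E // N.src e = y}, g e.1) =
      ∑ e : N.E, if N.src e = y then g e else 0 := by
  rw [← Finset.sum_filter]
  exact (@Finset.sum_subtype _ _ _ _ (N.finE y) _ (by simp) g).symm

theorem lapAt_apply_eq_sum_edges [Fintype N.E] [DecidableEq N.V] {M : Type} [AddCommGroup M]
    [Module R M] (y : N.V) (u : N.V → M) :
    N.lapAt y u = N.d y • u y +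
      ∑ e : N.E, if N.src e = y then N.w e • (u (N.src e) - u (N.tgt e)) else 0 := by
  rw [lapAt_apply, ← sum_src_eq]
  congr 1
  refine @Finset.sum_congr _ _ _ _ _ _ _ rfl fun e _ => ?_
  rw [e.2]

/-- The Laplacian on chains agrees with the Laplacian on functions. -/
theorem chainLap_apply [Fintype N.V] (z : N.V →₀ R) (y : N.V) :
    N.chainLap z y = N.lapAt y z := by
  classical
  let := N.fintypeEdge
  have hsingle (v : N.V) : N.lapSingle v y = N.d v * Finsupp.single v (1 : R) y +
      ∑ e : N.E, if N.src e = v then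
        N.w e * (Finsupp.single (N.src e) (1 : R) y - Finsupp.single (N.tgt e) 1 y) else 0 := by
    rw [← sum_src_eq]
    simp only [lapSingle, Finsupp.add_apply, Finsupp.smul_apply, Finsupp.finsetSum_apply,
      Finsupp.sub_apply, smul_eq_mul]
    congr 1
    refine @Finset.sum_congr _ _ _ _ _ _ _ rfl fun e _ => ?_
    rw [e.2]
  have hrev : ∑ e : N.E, z (N.src e) * (N.w e * Finsupp.single (N.tgt e) (1 : R) y) =
      ∑ e : N.E, z (N.tgt e) * (N.w e * Finsupp.single (N.src e) (1 : R) y) := by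
    refine Fintype.sum_equiv N.revEquiv _ _ fun e => ?_
    change _ = z (N.tgt (N.rev e)) * (N.w (N.rev e) * Finsupp.single (N.tgt e) (1 : R) y)
    rw [tgt_rev, N.w_rev]
  have hchain : N.chainLap z y = ∑ v, z v * N.lapSingle v y := by
    simp [chainLap, Finsupp.sum_fintype, Finsupp.finsetSum_apply]
  rw [hchain, lapAt_apply_eq_sum_edges]
  simp_rw [hsingle, mul_add, Finset.mul_sum, Finset.sum_add_distrib]
  rw [Finset.sum_comm]
  congr 1
  · simp [Finsupp.single_apply, mul_comm]
  · simp_rw [mul_ite, mul_zero]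
    simp only [Finset.sum_ite_eq, Finset.mem_univ, if_true, mul_sub, Finset.sum_sub_distrib]
    rw [hrev, ← Finset.sum_sub_distrib]
    refine Finset.sum_congr rfl fun e _ => ?_
    rw [Finsupp.single_apply]
    split_ifs
    · simp only [smul_eq_mul]; ring
    · ring

variable {N}

theorem mem_U0 {M : Type} [AddCommGroup M] [Module R M] {u : N.V →₀ M} :
    u ∈ N.U0 M ↔ (∀ v ∈ N.boundary, u v = 0) ∧ ∀ y, N.lapAt y (u : N.V → M) = 0 := by
  simp only [U0, Submodule.mem_inf, Submodule.mem_iInf, LinearMap.mem_ker]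
  rfl

theorem mem_U0_setBdry_singleton {M : Type} [AddCommGroup M] [Module R M] {x : N.V}
    {u : N.V →₀ M} :
    u ∈ (N.setBdry {x}).U0 M ↔ u x = 0 ∧ ∀ y, N.lapAt y (u : N.V → M) = 0 := by
  refine mem_U0.trans (and_congr_left fun _ => ?_)
  exact ⟨fun h => h x rfl, fun h v hv => (Set.mem_singleton_iff.mp hv) ▸ h⟩

theorem lapAt_const (hd : ∀ v, N.d v = 0) {M : Type} [AddCommGroup M] [Module R M]
    (y : N.V) (m : M) : N.lapAt y (fun _ => m) = 0 := by
  simp [lapAt_apply, hd]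

theorem sum_lapAt [Fintype N.V] (hd : ∀ v, N.d v = 0) {M : Type} [AddCommGroup M] [Module R M]
    (u : N.V → M) : ∑ y, N.lapAt y u = 0 := by
  classical
  let := N.fintypeEdge
  simp_rw [lapAt_apply_eq_sum_edges, hd, zero_smul, zero_add]
  rw [Finset.sum_comm]
  simp only [Finset.sum_ite_eq, Finset.mem_univ, if_true, smul_sub, Finset.sum_sub_distrib]
  rw [sub_eq_zero]
  refine Fintype.sum_equiv N.revEquiv _ _ fun e => ?_
  change _ = N.w (N.rev e) • u (N.tgt (N.rev e))
  rw [tgt_rev, N.w_rev]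

/-- The range of the Laplacian is attained on chains vanishing at a given vertex. -/
theorem exists_chainLap_eq_of_apply_eq_zero [Fintype N.V] (hd : ∀ v, N.d v = 0) (x : N.V)
    (z : N.V →₀ R) : ∃ z' : N.V →₀ R, z' x = 0 ∧ N.chainLap z' = N.chainLap z := by
  refine ⟨z - Finsupp.equivFunOnFinite.symm (fun _ => z x), by simp, ?_⟩
  ext y
  simp only [map_sub, Finsupp.sub_apply, chainLap_apply, sub_eq_self]
  exact lapAt_const hd y (z x)

theorem lapImage_setBdry_singleton [Fintype N.V] (hd : ∀ v, N.d v = 0) (x : N.V) :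
    (N.setBdry {x}).lapImage = LinearMap.range N.chainLap := by
  refine le_antisymm ?_ ?_
  · rintro _ ⟨z, -, rfl⟩
    exact ⟨z, rfl⟩
  · rintro _ ⟨z, rfl⟩
    obtain ⟨z', hx, hz⟩ := exists_chainLap_eq_of_apply_eq_zero hd x z
    refine ⟨z', ?_, hz⟩
    intro v hv hvx
    rw [Set.mem_singleton_iff.mp hvx] at hv
    exact Finsupp.mem_support_iff.mp hv hx

theorem lapImage_eq_range (hb : N.boundary = ∅) :
    N.lapImage = LinearMap.range N.chainLap := by
  simp [lapImage, interior, hb, Finsupp.supported_univ, Submodule.map_top]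

end DNetwork

namespace DNetwork

variable {N : DNetwork ℤ} [Fintype N.V]

/-- The maximum principle: a rational harmonic function on a finite connected graph vanishing at
some vertex is zero. -/
theorem eq_zero_of_lapAt_eq_zero (hconn : N.Connected) (hw : ∀ e, N.w e = 1)
    (hd : ∀ v, N.d v = 0) {x : N.V} {u : N.V → ℚ} (hx : u x = 0)
    (hu : ∀ y, N.lapAt y u = 0) : u = 0 := by
  have : Nonempty N.V := ⟨x⟩
  obtain ⟨m, hm⟩ := Finite.exists_max u
  have hconst (v : N.V) : u v = u m := by
    induction hconn m v with
    | refl => rfl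
    | @tail a b _ hab ih =>
      obtain ⟨e, rfl, rfl⟩ := hab
      let := N.finE (N.src e)
      have h := hu (N.src e)
      simp only [lapAt_apply, hd, hw, zero_smul, zero_add, one_smul] at h
      rw [Finset.sum_eq_zero_iff_of_nonneg
        (fun e' _ => sub_nonneg.mpr (ih ▸ hm (N.tgt e'.1)))] at h
      have := h ⟨e, rfl⟩ (Finset.mem_univ _)
      dsimp only at this
      linarith
  funext v
  rw [hconst v, ← hconst x, hx, Pi.zero_apply]

/-- The Poisson equation on a finite connected graph is solvable when the total charge is zero. -/
theorem exists_lapAt_eq (hconn : N.Connected) (hw : ∀ e, N.w e = 1) (hd : ∀ v, N.d v = 0)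
    (x : N.V) (c : N.V → ℚ) (hc : ∑ v, c v = 0) :
    ∃ u : N.V → ℚ, u x = 0 ∧ ∀ y, N.lapAt y u = c y := by
  classical
  let T : (N.V → ℚ) →ₗ[ℤ] (N.V → ℚ) := LinearMap.pi fun y =>
    N.lapAt y + (if y = x then (LinearMap.proj x : (N.V → ℚ) →ₗ[ℤ] ℚ) else 0)
  have hT (u : N.V → ℚ) (y : N.V) : T u y = N.lapAt y u + if y = x then u x else 0 := by
    simp only [T, LinearMap.pi_apply, LinearMap.add_apply]
    split_ifs <;> simp
  have hsum (u : N.V → ℚ) : ∑ y, T u y = u x := by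
    simp [hT, Finset.sum_add_distrib, sum_lapAt hd]
  let T' : (N.V → ℚ) →ₗ[ℚ] (N.V → ℚ) := T.toAddMonoidHom.toRatLinearMap
  have hinj : Function.Injective T' := by
    rw [injective_iff_map_eq_zero]
    intro u hu
    change T u = 0 at hu
    have hx : u x = 0 := by rw [← hsum u, hu]; simp
    refine eq_zero_of_lapAt_eq_zero hconn hw hd hx fun y => ?_
    simpa [hx, hu] using (hT u y).symm
  obtain ⟨u, hu⟩ := LinearMap.injective_iff_surjective.mp hinj c
  change T u = c at hu
  have hx : u x = 0 := by rw [← hsum u, hu, hc]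
  exact ⟨u, hx, fun y => by simpa [hx, hu] using (hT u y).symm⟩

variable (N) in
/-- Pairs of a rational potential vanishing at `x` and an integral chain equal to its
Laplacian. -/
noncomputable def integralPotentials (x : N.V) : Submodule ℤ ((N.V →₀ ℚ) × (N.V →₀ ℤ)) where
  carrier := {p | p.1 x = 0 ∧ ∀ y, N.lapAt y (p.1 : N.V → ℚ) = p.2 y}
  zero_mem' := ⟨rfl, fun y => by simp⟩
  add_mem' := by
    rintro p q ⟨hp, hp'⟩ ⟨hq, hq'⟩
    refine ⟨by simp [hp, hq], fun y => ?_⟩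
    simp [Finsupp.coe_add, hp', hq']
  smul_mem' := by
    rintro n p ⟨hp, hp'⟩
    refine ⟨by simp [hp], fun y => ?_⟩
    simp only [Prod.smul_fst, Prod.smul_snd, Finsupp.coe_smul, map_smul, hp', Pi.smul_apply]
    simp

theorem epsMap_apply (c : N.V →₀ ℤ) : epsMap N c = ∑ v, c v := by
  simp [epsMap, Finsupp.sum_fintype]

theorem epsMap_eq_zero_of_mem_integralPotentials (hd : ∀ v, N.d v = 0) {x : N.V}
    {p : (N.V →₀ ℚ) × (N.V →₀ ℤ)} (hp : p ∈ N.integralPotentials x) : epsMap N p.2 = 0 := by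
  have h := sum_lapAt hd (p.1 : N.V → ℚ)
  simp_rw [hp.2] at h
  rw [epsMap_apply]
  exact_mod_cast h

/-- The quotient map `ℚ → ℚ/ℤ`. -/
noncomputable abbrev ratModInt : ℚ →ₗ[ℤ] ℚ ⧸ LinearMap.range (Algebra.linearMap ℤ ℚ) :=
  (LinearMap.range (Algebra.linearMap ℤ ℚ)).mkQ

theorem ratModInt_eq_zero_iff {q : ℚ} : ratModInt q = 0 ↔ ∃ n : ℤ, (n : ℚ) = q := by
  simp [ratModInt]

/-- Reduction modulo `ℤ` of an integral potential. -/
noncomputable def potentialMod (x : N.V) : N.integralPotentials x →ₗ[ℤ]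
    (N.setBdry {x}).U0 (ℚ ⧸ LinearMap.range (Algebra.linearMap ℤ ℚ)) :=
  ((Finsupp.mapRange.linearMap ratModInt ∘ₗ LinearMap.fst ℤ _ _).domRestrict _).codRestrict _ <| by
    rintro ⟨p, hx, hp⟩
    refine mem_U0_setBdry_singleton.mpr ⟨?_, fun y => ?_⟩
    · change ratModInt (p.1 x) = 0
      rw [hx, map_zero]
    · change N.lapAt y (fun v => ratModInt (p.1 v)) = 0
      rw [← map_lapAt, hp]
      exact ratModInt_eq_zero_iff.mpr ⟨_, rfl⟩

theorem potentialMod_apply {x : N.V} (p : N.integralPotentials x) (v : N.V) :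
    (potentialMod x p).1 v = ratModInt (p.1.1 v) := rfl

theorem potentialMod_surjective (x : N.V) : Function.Surjective (potentialMod (N := N) x) := by
  classical
  rintro ⟨u, hu⟩
  obtain ⟨hx, hL⟩ := mem_U0_setBdry_singleton.mp hu
  choose s hs using fun v => Submodule.mkQ_surjective _ (u v)
  let t : N.V → ℚ := fun v => if v = x then 0 else s v
  have ht (v : N.V) : ratModInt (t v) = u v := by
    by_cases hv : v = x
    · rw [show t v = 0 from if_pos hv, map_zero, hv]
      exact hx.symm
    · simpa [t, hv] using hs v
  have hint (y : N.V) : ∃ n : ℤ, (n : ℚ) = N.lapAt y t := by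
    rw [← ratModInt_eq_zero_iff, map_lapAt]
    simp_rw [ht]
    exact hL y
  choose c hc using hint
  refine ⟨⟨(Finsupp.equivFunOnFinite.symm t, Finsupp.equivFunOnFinite.symm c),
    by simp [t], fun y => (hc y).symm⟩, ?_⟩
  ext v
  exact ht v

/-- The class of the Laplacian of an integral potential in the critical group. -/
noncomputable def potentialCrit (hd : ∀ v, N.d v = 0) (x : N.V) : N.integralPotentials x →ₗ[ℤ]
    Submodule.map N.lapImage.mkQ (LinearMap.ker (epsMap N)) :=
  ((N.lapImage.mkQ ∘ₗ LinearMap.snd ℤ _ _).domRestrict _).codRestrict _ fun p =>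
    ⟨p.1.2, epsMap_eq_zero_of_mem_integralPotentials hd p.2, rfl⟩

theorem potentialCrit_surjective (hconn : N.Connected) (hw : ∀ e, N.w e = 1)
    (hd : ∀ v, N.d v = 0) (x : N.V) : Function.Surjective (potentialCrit hd x) := by
  rintro ⟨_, c, hc, rfl⟩
  have hsum : ∑ v, (c v : ℚ) = 0 := by
    have := (epsMap_apply c).symm.trans hc
    exact_mod_cast this
  obtain ⟨u, hx, hu⟩ := exists_lapAt_eq hconn hw hd x (fun v => (c v : ℚ)) hsum
  exact ⟨⟨(Finsupp.equivFunOnFinite.symm u, c), hx, hu⟩, rfl⟩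

theorem cast_chainLap_apply (z : N.V →₀ ℤ) (y : N.V) :
    (N.chainLap z y : ℚ) = N.lapAt y (fun v => (z v : ℚ)) := by
  rw [chainLap_apply]
  exact N.map_lapAt (Algebra.linearMap ℤ ℚ) y z

theorem ker_potentialMod (hb : N.boundary = ∅) (hconn : N.Connected) (hw : ∀ e, N.w e = 1)
    (hd : ∀ v, N.d v = 0) (x : N.V) :
    LinearMap.ker (potentialMod x) = LinearMap.ker (potentialCrit hd x) := by
  ext p
  have hmod : potentialMod x p = 0 ↔ ∀ v, ∃ n : ℤ, (n : ℚ) = p.1.1 v := by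
    simp_rw [← ratModInt_eq_zero_iff, ← potentialMod_apply, Subtype.ext_iff, Finsupp.ext_iff]
    rfl
  have hcrit : potentialCrit hd x p = 0 ↔ ∃ z, N.chainLap z = p.1.2 := by
    rw [← LinearMap.mem_range, ← lapImage_eq_range hb, ← Submodule.Quotient.mk_eq_zero,
      Subtype.ext_iff]
    rfl
  obtain ⟨hx, hp⟩ := p.2
  rw [LinearMap.mem_ker, LinearMap.mem_ker, hmod, hcrit]
  constructor
  · intro h
    choose z hz using h
    refine ⟨Finsupp.equivFunOnFinite.symm z, Finsupp.ext fun y => ?_⟩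
    rw [← Int.cast_inj (α := ℚ), cast_chainLap_apply, ← hp]
    exact congrArg _ (funext hz)
  · rintro ⟨z, hz⟩
    obtain ⟨z', hx', hz'⟩ := exists_chainLap_eq_of_apply_eq_zero hd x z
    have h0 := eq_zero_of_lapAt_eq_zero hconn hw hd (x := x)
      (u := (p.1.1 : N.V → ℚ) - fun v => (z' v : ℚ)) (by simp [hx, hx']) fun y => by
        rw [map_sub, hp, ← cast_chainLap_apply, hz', hz, sub_self]
    exact fun v => ⟨z' v, (sub_eq_zero.mp (congrFun h0 v)).symm⟩

end DNetwork

/-- for a finite connected graph `G` without boundary with standard Laplacian,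
declaring a single vertex `x` to be a boundary vertex gives `L(ℤ(V∖{x})) = L(ℤV)`, hence the
fundamental modules agree, and `U₀(G', L_std, ℚ/ℤ) ≅ Crit(G)`. -/
theorem oneBoundaryVertex_lapImage_eq_and_u0_iso_crit (N : DNetwork ℤ) [Fintype N.V]
    (hb : N.boundary = ∅) (hconn : N.Connected)
    (hw : ∀ e, N.w e = 1) (hd : ∀ x, N.d x = 0) (x : N.V) :
    (N.setBdry {x}).lapImage = LinearMap.range N.chainLap ∧
      (N.setBdry {x}).lapImage = N.lapImage ∧
      Nonempty (↥((N.setBdry {x}).U0 (ℚ ⧸ LinearMap.range (Algebra.linearMap ℤ ℚ))) ≃ₗ[ℤ]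
        ↥(Submodule.map N.lapImage.mkQ (LinearMap.ker (epsMap N)))) := by
  refine ⟨DNetwork.lapImage_setBdry_singleton hd x,
    (DNetwork.lapImage_setBdry_singleton hd x).trans (DNetwork.lapImage_eq_range hb).symm, ⟨?_⟩⟩
  exact ((DNetwork.potentialMod x).quotKerEquivOfSurjective
      (DNetwork.potentialMod_surjective x)).symm ≪≫ₗ
    Submodule.quotEquivOfEq _ _ (DNetwork.ker_potentialMod hb hconn hw hd x) ≪≫ₗ
    (DNetwork.potentialCrit hd x).quotKerEquivOfSurjective
      (DNetwork.potentialCrit_surjective hconn hw hd x)
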